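/- Let X be a finite-dimensional real inner product space, let Ω* ⊆ X be nonempty, let x* ∈ Ω*, let ψ : X → ℝ, ψ* ∈ ℝ, and set δ_k := ψ(x^k) − ψ* for a sequence {x^k}_{k≥0} ⊆ X with x^k → x*. Assume: (i) δ_k ≥ 0, δ_{k+1} ≤ δ_k for all k, and δ_k → 0; (ii) there exist M₁, M₂, M₃ > 0 and positive reals {μ_k} such that for all k and all x̃ ∈ Ω*: (μ_k/M₁)·δ_{k+1} ≤ ‖x^k − x̃‖² − ‖x^{k+1} − x̃‖² + M₂·μ_k² + M₃·(δ_k − δ_{k+1}); (iii) there exist c₁, c₂ > 0, r̄ ∈ (1/2, 1) and k̄₀ ∈ ℕ₀ with c₁·(k+1)^{−r̄} ≤ μ_k ≤ c₂·(k+1)^{−r̄} for all k ≥ k̄₀; and (iv) there exist κ > 0, θ ∈ (0,1), ε₀ > 0, ε₁ ∈ (0,1) such that dist(x^k, Ω*) ≤ κ·δ_k^{1−θ} whenever dist(x^k, Ω*) ≤ ε₀ and δ_k ≤ ε₁, and dist(x^k, Ω*) → 0. Then there exist k₁ ∈ ℕ₀ and κ₁ > 0 such that ‖x^k − x*‖ ≤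 κ₁·(k+1)^{−s} for all k ≥ k₁, where s = r̄ − 1/2 if θ ∈ (0, 1/2], and s = min{r̄ − 1/2, (1−r̄)(1−θ)/(2θ−1)} if θ ∈ (1/2, 1). -/

import Mathlib

open scoped InnerProductSpace

lemma aux_ratio {t : ℝ} (ht : 1 ≤ t) (p : ℝ) :
    (t + 1) ^ (-p) = t ^ (-p) * (t / (t + 1)) ^ p := by
  have h0 : 0 < t := by linarith
  rw [Real.div_rpow h0.le (by linarith), Real.rpow_neg h0.le, Real.rpow_neg (by linarith)]
  have := (Real.rpow_pos_of_pos h0 p).ne'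
  field_simp

lemma aux_lower {t p : ℝ} (ht : 1 ≤ t) (hp1 : p ≤ 1) :
    t ^ (-p) * (t / (t + 1)) ≤ (t + 1) ^ (-p) := by
  have h0 : 0 < t := by linarith
  rw [aux_ratio ht]
  gcongr
  apply Real.self_le_rpow_of_le_one (by positivity) _ hp1
  rw [div_le_one (by linarith)]; linarith

lemma aux_upper {t a : ℝ} (ht : 1 ≤ t) (ha0 : 0 ≤ a) (ha1 : a ≤ 1) :
    (t + 1) ^ (-a) + a / 2 * t ^ (-a - 1) ≤ t ^ (-a) := by
  have h0 : 0 < t := by linarith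
  have h1 : (t / (t + 1)) ^ a ≤ 1 - a / (t + 1) := by
    have e : t / (t + 1) = 1 + (-(1 / (t + 1))) := by field_simp; ring
    have hb : 1 / (t + 1) ≤ 1 := by rw [div_le_one (by linarith)]; linarith
    have := rpow_one_add_le_one_add_mul_self (s := -(1 / (t + 1))) (by linarith) ha0 ha1
    rw [e]
    refine this.trans (le_of_eq ?_)
    ring
  have h2 : a / 2 * t⁻¹ ≤ a / (t + 1) := by
    rw [div_mul_eq_mul_div, div_le_div_iff₀ (by norm_num) (by linarith)]
    have : t⁻¹ * (t + 1) ≤ 2 := by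
      rw [inv_mul_le_iff₀ h0]; linarith
    nlinarith
  have h3 := Real.rpow_pos_of_pos h0 (-a)
  rw [aux_ratio ht, Real.rpow_sub h0, Real.rpow_one, div_eq_mul_inv (t ^ (-a)) t]
  nlinarith [mul_le_mul_of_nonneg_left h1 h3.le, mul_le_mul_of_nonneg_left h2 h3.le]

lemma aux_rate (β : ℕ → ℝ) (N : ℕ) (c C q p r : ℝ) (hc : 0 < c) (hC : 0 ≤ C)
    (hq : 1 < q) (hp0 : 0 < p) (hp1 : p ≤ 1) (hpq : p * (q - 1) ≤ 1 - r) (hpr : p ≤ 2 * r - 1)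
    (hrec : ∀ k, N ≤ k → β (k + 1) + c * ((k : ℝ) + 1) ^ (-r) * β (k + 1) ^ q
      ≤ β k + C * ((k : ℝ) + 1) ^ (-(2 * r))) :
    ∃ A : ℝ, 0 < A ∧ ∀ k, N ≤ k → β k ≤ A * ((k : ℝ) + 1) ^ (-p) := by
  have hev : ∀ᶠ A : ℝ in Filter.atTop, 2 / (c * (1 / 2) ^ q) ≤ A ^ (q - 1) :=
    (tendsto_rpow_atTop (by linarith : 0 < q - 1)).eventually_ge_atTop _
  obtain ⟨A, hA1, hA2, hA3, hA4⟩ := (hev.and ((Filter.eventually_ge_atTop 1).and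
    ((Filter.eventually_ge_atTop C).and
      (Filter.eventually_ge_atTop (β N * ((N : ℝ) + 1) ^ p))))).exists
  have hA0 : 0 < A := by linarith
  have hcq : 0 < c * (1 / 2 : ℝ) ^ q := by positivity
  have hAq : A + C ≤ c * (1 / 2 : ℝ) ^ q * A ^ q := by
    rw [div_le_iff₀ hcq] at hA1
    have e : A ^ q = A ^ (q - 1) * A := by
      rw [Real.rpow_sub hA0, Real.rpow_one]; field_simp
    rw [e]; nlinarith
  refine ⟨A, hA0, fun k hk => ?_⟩
  induction k, hk using Nat.le_induction with
  | base =>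
    have h0 : (0 : ℝ) < (N : ℝ) + 1 := by positivity
    rw [Real.rpow_neg h0.le, ← div_eq_mul_inv, le_div_iff₀ (Real.rpow_pos_of_pos h0 p)]
    exact hA4
  | succ k hk ih =>
    by_contra hcon
    push Not at hcon
    have hr := hrec k hk
    push_cast at hcon
    set t : ℝ := (k : ℝ) + 1 with htdef
    have ht : 1 ≤ t := by rw [htdef]; linarith [(Nat.cast_nonneg k : (0 : ℝ) ≤ k)]
    have h0 : 0 < t := by linarith
    have hl := aux_lower ht hp1
    have htp := Real.rpow_pos_of_pos h0 (-p)
    have htr := Real.rpow_pos_of_pos h0 (-r)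
    have hhalf : 1 / 2 ≤ t / (t + 1) := by
      rw [div_le_div_iff₀ (by norm_num) (by linarith)]; linarith
    have hl2 : t ^ (-p) * (1 / 2) ≤ (t + 1) ^ (-p) := le_trans (by gcongr) hl
    have hl3 : t ^ (-p) - t ^ (-p - 1) ≤ (t + 1) ^ (-p) := by
      refine le_trans ?_ hl
      rw [Real.rpow_sub h0, Real.rpow_one, div_eq_mul_inv]
      have : 1 - t⁻¹ ≤ t / (t + 1) := by
        rw [le_div_iff₀ (by linarith)]
        have : t⁻¹ * t = 1 := inv_mul_cancel₀ h0.ne'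
        have : 0 < t⁻¹ := by positivity
        nlinarith
      nlinarith
    have hq1 : A ^ q * (t ^ (-(p * q)) * (1 / 2) ^ q) ≤ β (k + 1) ^ q := by
      have : A * (t ^ (-p) * (1 / 2)) ≤ β (k + 1) := by
        refine le_trans ?_ hcon.le
        gcongr
      have h := Real.rpow_le_rpow (by positivity) this (by linarith : (0 : ℝ) ≤ q)
      rw [Real.mul_rpow hA0.le (by positivity), Real.mul_rpow htp.le (by norm_num),
        ← Real.rpow_mul h0.le] at h
      rwa [neg_mul] at h
    have hS : t ^ (-r) * t ^ (-(p * q)) = t ^ (-(r + p * q)) := by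
      rw [← Real.rpow_add h0]; congr 1; ring
    have hS1 : t ^ (-p - 1) ≤ t ^ (-(r + p * q)) :=
      Real.rpow_le_rpow_of_exponent_le ht (by nlinarith)
    have hS2 : t ^ (-(2 * r)) ≤ t ^ (-(r + p * q)) :=
      Real.rpow_le_rpow_of_exponent_le ht (by nlinarith)
    have hS0 := Real.rpow_pos_of_pos h0 (-(r + p * q))
    have h1 : (c * (1 / 2) ^ q * A ^ q) * t ^ (-(r + p * q)) ≤ c * t ^ (-r) * β (k + 1) ^ q := by
      rw [← hS]
      calc _ = c * t ^ (-r) * (A ^ q * (t ^ (-(p * q)) * (1 / 2) ^ q)) := by ring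
        _ ≤ _ := by gcongr
    have h2 : (A + C) * t ^ (-(r + p * q)) ≤ (c * (1 / 2) ^ q * A ^ q) * t ^ (-(r + p * q)) := by
      gcongr
    have h3 : A * (t ^ (-p) - t ^ (-p - 1)) ≤ A * (t + 1) ^ (-p) := by gcongr
    have h4 : A * t ^ (-p - 1) ≤ A * t ^ (-(r + p * q)) := by gcongr
    have h5 : C * t ^ (-(2 * r)) ≤ C * t ^ (-(r + p * q)) := by gcongr
    linarith

lemma aux_inf {X : Type*} [NormedAddCommGroup X] (Ω : Set X) (hΩ : Ω.Nonempty) (y : X)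
    (L c R : ℝ) (hc : 0 ≤ c) (h : ∀ z ∈ Ω, L ≤ c * ‖y - z‖ ^ 2 + R) :
    L ≤ c * Metric.infDist y Ω ^ 2 + R := by
  have ht : Filter.Tendsto (fun u : ℝ => c * u ^ 2 + R) (nhdsWithin (Metric.infDist y Ω)
      (Set.Ioi (Metric.infDist y Ω))) (nhds (c * Metric.infDist y Ω ^ 2 + R)) := by
    apply Filter.Tendsto.mono_left _ nhdsWithin_le_nhds
    exact Continuous.tendsto (by fun_prop) _
  refine ge_of_tendsto ht ?_
  filter_upwards [self_mem_nhdsWithin] with u hu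
  obtain ⟨z, hz, hzu⟩ := (Metric.infDist_lt_iff hΩ).1 hu
  rw [dist_eq_norm] at hzu
  refine (h z hz).trans ?_
  gcongr

lemma aux_main
    {X : Type*} [NormedAddCommGroup X]
    (Ω : Set X) (hΩ : Ω.Nonempty) (xs : X)
    (x : ℕ → X) (hconv : Filter.Tendsto x Filter.atTop (nhds xs))
    (δ : ℕ → ℝ)
    (hδnonneg : ∀ k : ℕ, 0 ≤ δ k)
    (hδ0 : Filter.Tendsto δ Filter.atTop (nhds 0))
    (M₁ M₂ M₃ : ℝ) (hM₁ : 0 < M₁) (hM₂ : 0 < M₂) (hM₃ : 0 < M₃)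
    (μ : ℕ → ℝ) (hμpos : ∀ k, 0 < μ k)
    (hiter : ∀ k : ℕ, ∀ xt ∈ Ω,
      μ k / M₁ * δ (k + 1) ≤
        ‖x k - xt‖ ^ 2 - ‖x (k + 1) - xt‖ ^ 2 + M₂ * μ k ^ 2 + M₃ * (δ k - δ (k + 1)))
    (c₁ c₂ r : ℝ) (hc₁ : 0 < c₁) (hc₂ : 0 < c₂)
    (hr_lb : 1 / 2 < r) (hr_ub : r < 1)
    (k₀ : ℕ)
    (hμbound : ∀ k : ℕ, k₀ ≤ k →
      c₁ * ((k : ℝ) + 1) ^ (-r) ≤ μ k ∧ μ k ≤ c₂ * ((k : ℝ) + 1) ^ (-r))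
    (κ θ ε₀ ε₁ : ℝ) (hκ : 0 < κ)
    (hε₀ : 0 < ε₀) (hε₁0 : 0 < ε₁) (hε₁1 : ε₁ < 1)
    (hKL : ∀ k : ℕ, Metric.infDist (x k) Ω ≤ ε₀ → δ k ≤ ε₁ →
      Metric.infDist (x k) Ω ≤ κ * δ k ^ (1 - θ))
    (hdist0 : Filter.Tendsto (fun k => Metric.infDist (x k) Ω) Filter.atTop (nhds 0))
    (q s : ℝ) (hq : 1 < q) (hqθ : 1 / q ≤ 2 * (1 - θ)) (hs0 : 0 < s) (hsr : s ≤ r - 1 / 2)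
    (hsq : 2 * s * (q - 1) ≤ 1 - r) :
    ∃ k₁ : ℕ, ∃ κ₁ : ℝ, 0 < κ₁ ∧ ∀ k : ℕ, k₁ ≤ k →
      ‖x k - xs‖ ≤ κ₁ * ((k : ℝ) + 1) ^ (-s) := by
  have hev := ((hdist0.eventually (ge_mem_nhds hε₀)).and
    ((hδ0.eventually (ge_mem_nhds hε₁0)).and (Filter.eventually_ge_atTop k₀)))
  obtain ⟨N, hN⟩ := Filter.eventually_atTop.1 hev
  have hμ2 : ∀ k, N ≤ k → M₂ * μ k ^ 2 ≤ (M₂ * c₂ ^ 2) * ((k : ℝ) + 1) ^ (-(2 * r)) := by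
    intro k hk
    have h0 : (0 : ℝ) < (k : ℝ) + 1 := by positivity
    have e : ((k : ℝ) + 1) ^ (-(2 * r)) = (((k : ℝ) + 1) ^ (-r)) ^ 2 := by
      rw [← Real.rpow_natCast, ← Real.rpow_mul h0.le]; congr 1; push_cast; ring
    rw [e, mul_assoc, ← mul_pow]
    have := (hμbound k (hN k hk).2.2).2
    have := (hμpos k).le
    gcongr
  set β : ℕ → ℝ := fun k => Metric.infDist (x k) Ω ^ 2 + M₃ * δ k with hβ
  have hβ0 : ∀ k, 0 ≤ β k := fun k => by have := hδnonneg k; simp only [hβ]; positivity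
  set K : ℝ := κ ^ 2 + M₃ with hK
  have hK0 : 0 < K := by positivity
  have hKq : 0 < K ^ q := Real.rpow_pos_of_pos hK0 q
  have hgrow : ∀ k, N ≤ k → β k ^ q ≤ K ^ q * δ k := by
    intro k hk
    obtain ⟨h1, h2, -⟩ := hN k hk
    have hd := hKL k h1 h2
    have hn := hδnonneg k
    have hq0 : 0 ≤ 1 / q := by positivity
    have hq1 : 1 / q ≤ 1 := by rw [div_le_one (by linarith)]; exact hq.le
    have hle1 : δ k ≤ 1 := by linarith
    have ha : δ k ≤ δ k ^ (1 / q) := Real.self_le_rpow_of_le_one hn hle1 hq1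
    have hb : Metric.infDist (x k) Ω ^ 2 ≤ κ ^ 2 * δ k ^ (1 / q) := by
      calc _ ≤ (κ * δ k ^ (1 - θ)) ^ 2 := by
            have := @Metric.infDist_nonneg _ _ Ω (x k)
            gcongr
        _ = κ ^ 2 * δ k ^ (2 * (1 - θ)) := by
            rw [mul_pow, ← Real.rpow_natCast (δ k ^ (1 - θ)), ← Real.rpow_mul hn]
            congr 2; push_cast; ring
        _ ≤ _ := by
            exact mul_le_mul_of_nonneg_left
              (Real.rpow_le_rpow_of_exponent_ge' hn hle1 hq0 hqθ) (by positivity)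
    have hc : β k ≤ K * δ k ^ (1 / q) := by
      simp only [hβ, hK]; nlinarith
    have h := Real.rpow_le_rpow (hβ0 k) hc (by linarith : (0 : ℝ) ≤ q)
    rwa [Real.mul_rpow hK0.le (by positivity), ← Real.rpow_mul hn, one_div,
      inv_mul_cancel₀ (by linarith), Real.rpow_one] at h
  have hrec : ∀ k, N ≤ k → β (k + 1) + c₁ / (M₁ * K ^ q) * ((k : ℝ) + 1) ^ (-r) * β (k + 1) ^ q
      ≤ β k + (M₂ * c₂ ^ 2) * ((k : ℝ) + 1) ^ (-(2 * r)) := by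
    intro k hk
    have h1 : μ k / M₁ * δ (k + 1) + Metric.infDist (x (k + 1)) Ω ^ 2 + M₃ * δ (k + 1)
        ≤ 1 * Metric.infDist (x k) Ω ^ 2 + (M₂ * μ k ^ 2 + M₃ * δ k) := by
      apply aux_inf Ω hΩ _ _ _ _ zero_le_one
      intro z hz
      have h := hiter k z hz
      have h' : Metric.infDist (x (k + 1)) Ω ^ 2 ≤ ‖x (k + 1) - z‖ ^ 2 := by
        have := @Metric.infDist_nonneg _ _ Ω (x (k + 1))
        have h2 := Metric.infDist_le_dist_of_mem (x := x (k + 1)) hz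
        rw [dist_eq_norm] at h2
        gcongr
      linarith
    have h2 : c₁ / (M₁ * K ^ q) * ((k : ℝ) + 1) ^ (-r) * β (k + 1) ^ q ≤ μ k / M₁ * δ (k + 1) := by
      have hg := hgrow (k + 1) (by omega)
      have hm := (hμbound k (hN k hk).2.2).1
      have hn := hδnonneg (k + 1)
      calc _ ≤ c₁ / (M₁ * K ^ q) * ((k : ℝ) + 1) ^ (-r) * (K ^ q * δ (k + 1)) := by gcongr
        _ = (c₁ * ((k : ℝ) + 1) ^ (-r)) / M₁ * δ (k + 1) := by field_simp
        _ ≤ _ := by gcongr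
    have h3 := hμ2 k hk
    simp only [hβ] at h2 ⊢
    linarith
  obtain ⟨A, hA0, hA⟩ := aux_rate β N (c₁ / (M₁ * K ^ q)) (M₂ * c₂ ^ 2) q (2 * s) r
    (by positivity) (by positivity) hq (by linarith) (by linarith) hsq (by linarith) hrec
  -- Fejer type estimate
  set a : ℝ := 2 * r - 1 with ha
  have ha0 : 0 < a := by linarith
  set D : ℝ := M₂ * c₂ ^ 2 * (2 / a) with hD
  have hD0 : 0 < D := by positivity
  have hfej : ∀ k, N ≤ k → ∀ z ∈ Ω,
      ‖xs - z‖ ^ 2 ≤ ‖x k - z‖ ^ 2 + M₃ * δ k + D * ((k : ℝ) + 1) ^ (-a) := by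
    intro k hk z hz
    have hstep : ∀ m, k ≤ m → ‖x m - z‖ ^ 2 + M₃ * δ m + D * ((m : ℝ) + 1) ^ (-a) ≤
        ‖x k - z‖ ^ 2 + M₃ * δ k + D * ((k : ℝ) + 1) ^ (-a) := by
      intro m hm
      induction m, hm using Nat.le_induction with
      | base => exact le_rfl
      | succ m hm ih =>
        refine le_trans ?_ ih
        have h1 := hiter m z hz
        have h2 := hμ2 m (by omega)
        have h3 : 0 ≤ μ m / M₁ * δ (m + 1) := by
          have := hδnonneg (m + 1)
          have := hμpos m
          positivity
        have h4 := aux_upper (t := (m : ℝ) + 1) (a := a)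
          (by linarith [(Nat.cast_nonneg m : (0 : ℝ) ≤ m)]) ha0.le (by linarith)
        have h5 : D * (a / 2 * ((m : ℝ) + 1) ^ (-a - 1))
            = M₂ * c₂ ^ 2 * ((m : ℝ) + 1) ^ (-(2 * r)) := by
          rw [show -a - 1 = -(2 * r) by rw [ha]; ring, hD]; field_simp
        have h6 := mul_le_mul_of_nonneg_left h4 hD0.le
        push_cast
        rw [mul_add] at h6
        linarith
    have hlim : Filter.Tendsto (fun m => ‖x m - z‖ ^ 2) Filter.atTop (nhds (‖xs - z‖ ^ 2)) :=
      ((hconv.sub_const z).norm).pow 2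
    refine le_of_tendsto hlim ?_
    filter_upwards [Filter.eventually_ge_atTop k] with m hm
    have h := hstep m hm
    have h1 : 0 ≤ M₃ * δ m := mul_nonneg hM₃.le (hδnonneg m)
    have h2 : 0 ≤ D * ((m : ℝ) + 1) ^ (-a) := by positivity
    linarith
  refine ⟨N, Real.sqrt (4 * A + 2 * D), by positivity, fun k hk => ?_⟩
  have hinf : ‖x k - xs‖ ^ 2 ≤ 4 * Metric.infDist (x k) Ω ^ 2 +
      (2 * (M₃ * δ k) + 2 * (D * ((k : ℝ) + 1) ^ (-a))) := by
    apply aux_inf Ω hΩ _ _ _ _ (by norm_num)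
    intro z hz
    have h := hfej k hk z hz
    have ht : ‖x k - xs‖ ≤ ‖x k - z‖ + ‖xs - z‖ := by
      have := norm_sub_le (x k - z) (xs - z)
      simpa using this
    have h2 : ‖x k - xs‖ ^ 2 ≤ (‖x k - z‖ + ‖xs - z‖) ^ 2 := by gcongr
    nlinarith [sq_nonneg (‖x k - z‖ - ‖xs - z‖)]
  have h0 : (0 : ℝ) < (k : ℝ) + 1 := by positivity
  have h1 : (1 : ℝ) ≤ (k : ℝ) + 1 := by linarith [(Nat.cast_nonneg k : (0 : ℝ) ≤ k)]
  have hpow : ((k : ℝ) + 1) ^ (-a) ≤ ((k : ℝ) + 1) ^ (-(2 * s)) :=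
    Real.rpow_le_rpow_of_exponent_le h1 (by linarith)
  have hb := hA k hk
  have hδ' : 0 ≤ M₃ * δ k := mul_nonneg hM₃.le (hδnonneg k)
  have e : ((k : ℝ) + 1) ^ (-(2 * s)) = (((k : ℝ) + 1) ^ (-s)) ^ 2 := by
    rw [← Real.rpow_natCast, ← Real.rpow_mul h0.le]; congr 1; push_cast; ring
  have hD1 := mul_le_mul_of_nonneg_left hpow hD0.le
  have hfin : ‖x k - xs‖ ^ 2 ≤ (4 * A + 2 * D) * (((k : ℝ) + 1) ^ (-s)) ^ 2 := by
    rw [← e]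
    simp only [hβ] at hb
    linarith
  apply le_of_sq_le_sq _ (by positivity)
  rw [mul_pow, Real.sq_sqrt (by positivity)]
  exact hfin

/-- Local convergence rate of the smoothing MBA method in the convex setting under a
Hölderian growth condition: `‖x^k - x*‖ ≤ κ₁ (k+1)^{-s}` for all large `k`, where
`s = r̄ - 1/2` if `θ ∈ (0, 1/2]` and
`s = min{r̄ - 1/2, (1-r̄)(1-θ)/(2θ-1)}` if `θ ∈ (1/2, 1)`. -/
theorem smba_local_rate_under_holder_growth
    {X : Type*} [NormedAddCommGroup X] [InnerProductSpace ℝ X] [FiniteDimensional ℝ X]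
    (Ω : Set X) (hΩ : Ω.Nonempty) (xs : X) (hxs : xs ∈ Ω)
    (ψ : X → ℝ) (ψopt : ℝ)
    (x : ℕ → X) (hconv : Filter.Tendsto x Filter.atTop (nhds xs))
    -- (i) the gaps δ_k := ψ(x^k) - ψ* are nonnegative, nonincreasing and tend to 0
    (hδnonneg : ∀ k : ℕ, 0 ≤ ψ (x k) - ψopt)
    (hδmono : ∀ k : ℕ, ψ (x (k + 1)) - ψopt ≤ ψ (x k) - ψopt)
    (hδ0 : Filter.Tendsto (fun k => ψ (x k) - ψopt) Filter.atTop (nhds 0))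
    -- (ii) per-iteration estimate
    (M₁ M₂ M₃ : ℝ) (hM₁ : 0 < M₁) (hM₂ : 0 < M₂) (hM₃ : 0 < M₃)
    (μ : ℕ → ℝ) (hμpos : ∀ k, 0 < μ k)
    (hiter : ∀ k : ℕ, ∀ xt ∈ Ω,
      μ k / M₁ * (ψ (x (k + 1)) - ψopt) ≤
        ‖x k - xt‖ ^ 2 - ‖x (k + 1) - xt‖ ^ 2 + M₂ * μ k ^ 2
          + M₃ * ((ψ (x k) - ψopt) - (ψ (x (k + 1)) - ψopt)))
    -- (iii) decay rate of the smoothing parameters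
    (c₁ c₂ rbar : ℝ) (hc₁ : 0 < c₁) (hc₂ : 0 < c₂)
    (hrbar_lb : 1 / 2 < rbar) (hrbar_ub : rbar < 1)
    (k₀ : ℕ)
    (hμbound : ∀ k : ℕ, k₀ ≤ k →
      c₁ * ((k : ℝ) + 1) ^ (-rbar) ≤ μ k ∧ μ k ≤ c₂ * ((k : ℝ) + 1) ^ (-rbar))
    -- (iv) Hölderian growth condition
    (κ θ ε₀ ε₁ : ℝ) (hκ : 0 < κ) (hθ0 : 0 < θ) (hθ1 : θ < 1)
    (hε₀ : 0 < ε₀) (hε₁0 : 0 < ε₁) (hε₁1 : ε₁ < 1)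
    (hKL : ∀ k : ℕ, Metric.infDist (x k) Ω ≤ ε₀ → ψ (x k) - ψopt ≤ ε₁ →
      Metric.infDist (x k) Ω ≤ κ * (ψ (x k) - ψopt) ^ (1 - θ))
    (hdist0 : Filter.Tendsto (fun k => Metric.infDist (x k) Ω) Filter.atTop (nhds 0)) :
    ∃ k₁ : ℕ, ∃ κ₁ : ℝ, 0 < κ₁ ∧ ∀ k : ℕ, k₁ ≤ k →
      ‖x k - xs‖ ≤ κ₁ * ((k : ℝ) + 1) ^
        (-(if θ ≤ 1 / 2 then rbar - 1 / 2
          else min (rbar - 1 / 2) ((1 - rbar) * (1 - θ) / (2 * θ - 1)))) := by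
  have key := aux_main Ω hΩ xs x hconv (fun k => ψ (x k) - ψopt) hδnonneg hδ0 M₁ M₂ M₃
    hM₁ hM₂ hM₃ μ hμpos hiter c₁ c₂ rbar hc₁ hc₂ hrbar_lb hrbar_ub k₀ hμbound κ θ ε₀ ε₁ hκ
    hε₀ hε₁0 hε₁1 hKL hdist0
  split_ifs with hθ
  · apply key (2 - rbar) (rbar - 1 / 2) (by linarith) _ (by linarith) le_rfl (by nlinarith)
    rw [div_le_iff₀ (by linarith)]
    nlinarith
  · push Not at hθ
    have h1 : 0 < 2 * θ - 1 := by linarith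
    have h2 : 0 < 1 - θ := by linarith
    have h3 : 0 < 1 - rbar := by linarith
    refine key (1 / (2 * (1 - θ))) _ ?_ ?_ ?_ (min_le_left _ _) ?_
    · rw [lt_div_iff₀ (by linarith)]; linarith
    · rw [one_div_one_div]
    · exact lt_min (by linarith) (by positivity)
    · have e : 1 / (2 * (1 - θ)) - 1 = (2 * θ - 1) / (2 * (1 - θ)) := by
        field_simp; ring
      rw [e]
      calc _ ≤ 2 * ((1 - rbar) * (1 - θ) / (2 * θ - 1)) * ((2 * θ - 1) / (2 * (1 - θ))) := by
            gcongr
            exact min_le_right _ _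
        _ = 1 - rbar := by field_simp
        _ ≤ _ := le_rfl
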